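/- If the number n of leaves is an exact power of two, n = 2^k, then for every index i < n the inclusion proof for index i contains exactly k sibling hashes. -/

import Mathlib

/-- Side of a sibling hash in an inclusion proof. -/
inductive Side
  | left
  | right
deriving DecidableEq, Repr

/-- One Merkle level step: combine consecutive pairs with `H`,
promoting an unpaired final element unchanged. -/
def levelStep {α : Type*} (H : α → α → α) : List α → List α
  | a :: b :: rest => H a b :: levelStep H rest
  | l => l

theorem levelStep_length {α : Type*} (H : α → α → α) :
    (l : List α) → (levelStep H l).length = (l.length + 1) / 2
  | [] => by simp [levelStep]
  | [_] => by simp [levelStep]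
  | a :: b :: rest => by
      simp only [levelStep, List.length_cons, levelStep_length H rest]
      omega

/-- The inclusion proof for leaf index `i`: the list of sibling hashes,
tagged with their side, along the path from leaf `i` to the root. -/
def merkleProof {α : Type*} (H : α → α → α) : List α → ℕ → List (Side × α)
  | [], _ => []
  | [_], _ => []
  | (a :: b :: rest), i =>
      (if i % 2 = 0 then
        match (a :: b :: rest)[i + 1]? with
        | some s => [(Side.right, s)]
        | none => []
      else
        match (a :: b :: rest)[i - 1]? with
        | some s => [(Side.left, s)]
        | none => []) ++ merkleProof H (levelStep H (a :: b :: rest)) (i / 2)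
termination_by l _ => l.length
decreasing_by
  simp only [levelStep_length, List.length_cons]
  omega

/-- If the number `n` of leaves is an exact power of two, `n = 2 ^ k`, then for
every index `i < n` the inclusion proof for index `i` contains exactly `k`
sibling hashes. -/
theorem merkleProof_length_of_pow_two {α : Type*} (H : α → α → α)
    (hs : List α) (k : ℕ) (hlen : hs.length = 2 ^ k) (i : ℕ) (hi : i < hs.length) :
    (merkleProof H hs i).length = k := by
  induction k generalizing hs i with
  | zero =>
    match hs, hlen with
    | [x], _ => simp [merkleProof]
  | succ k ih =>
    have hp : 0 < 2 ^ k := Nat.two_pow_pos k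
    rw [pow_succ] at hlen
    match hs, hlen, hi with
    | [], hlen, _ => simp only [List.length_nil] at hlen; omega
    | [x], hlen, _ => simp only [List.length_cons, List.length_nil] at hlen; omega
    | a :: b :: rest, hlen, hi =>
      have hl : (levelStep H (a :: b :: rest)).length = 2 ^ k := by
        rw [levelStep_length, hlen]; omega
      have h2 := ih (levelStep H (a :: b :: rest)) hl (i / 2) (by rw [hl]; omega)
      rw [merkleProof, List.length_append, h2]
      split
      · have : i + 1 < (a :: b :: rest).length := by omega
        rw [List.getElem?_eq_getElem this]
        simp only [List.length_cons, List.length_nil]; omega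
      · have : i - 1 < (a :: b :: rest).length := by omega
        rw [List.getElem?_eq_getElem this]
        simp only [List.length_cons, List.length_nil]; omega
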